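/- Let A be an Artin algebra with wrd(A) = m, witnessed by a module M with M-wrd(A) = m. Then A-mod = [⊕_{i=0}^m Ω^{-i}(M)]_{m+1}, and hence ed(A) ≤ m. -/

import Mathlib

universe u

open CategoryTheory

namespace Paper

variable (A : Type u) [Ring A]

/-- `X` belongs to `add 𝒮`: it is a direct summand of a finite direct sum of members of `𝒮`. -/
def memAdd (S : Set (ModuleCat.{u} A)) (X : ModuleCat.{u} A) : Prop :=
  ∃ (n : ℕ) (M : Fin n → ModuleCat.{u} A) (Y : ModuleCat.{u} A),
    (∀ i, M i ∈ S) ∧ Nonempty ((X × Y) ≃ₗ[A] ((i : Fin n) → M i))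

/-- `add T` for a single module `T`. -/
def addOf (T : ModuleCat.{u} A) : Set (ModuleCat.{u} A) :=
  {X | memAdd A {T} X}

/-- `0 → X → Y → Z → 0` is a short exact sequence. -/
def IsSES {X Y Z : ModuleCat.{u} A} (f : X →ₗ[A] Y) (g : Y →ₗ[A] Z) : Prop :=
  Function.Injective f ∧ Function.Surjective g ∧ LinearMap.range f = LinearMap.ker g

/-- The extension product `𝒮 • 𝒯` of two classes of modules. -/
def bullet (S T : Set (ModuleCat.{u} A)) : Set (ModuleCat.{u} A) :=
  {X | memAdd A {W | Module.Finite A W ∧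
    ∃ (T₁ T₂ : ModuleCat.{u} A) (f : T₁ →ₗ[A] W) (g : W →ₗ[A] T₂),
      T₁ ∈ S ∧ T₂ ∈ T ∧ IsSES A f g} X}

/-- `[T]ₙ`. -/
def bracket (T : ModuleCat.{u} A) : ℕ → Set (ModuleCat.{u} A)
  | 0 => {X | Subsingleton X}
  | 1 => addOf A T
  | (n+2) => bullet A (addOf A T) (bracket T (n+1))

/-- The extension dimension of `A`. -/
noncomputable def extDim : ℕ∞ :=
  sInf {d : ℕ∞ | ∃ n : ℕ, d = n ∧ ∃ T : ModuleCat.{u} A, Module.Finite A T ∧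
    ∀ X : ModuleCat.{u} A, Module.Finite A X → X ∈ bracket A T (n + 1)}

/-- There is an exact sequence `0 → M_n → ⋯ → M_0 → X → 0` with all `M_i ∈ add M`. -/
def ResLen (M : ModuleCat.{u} A) : ModuleCat.{u} A → ℕ → Prop
  | X, 0 => X ∈ addOf A M
  | X, (n+1) => ∃ (M₀ : ModuleCat.{u} A) (g : M₀ →ₗ[A] X),
      M₀ ∈ addOf A M ∧ Function.Surjective g ∧
        ResLen M (ModuleCat.of A (LinearMap.ker g)) n

/-- `M`-wrd(X) ≤ n : there is an exact sequence `0 → M_n → ⋯ → M_0 → X ⊕ Y → 0`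
with all `M_i ∈ add M`. -/
def wrdLE (M X : ModuleCat.{u} A) (n : ℕ) : Prop :=
  ∃ Y : ModuleCat.{u} A, Module.Finite A Y ∧ ResLen A M (ModuleCat.of A (X × Y)) n

/-- The weak `M`-resolution dimension of `X`. -/
noncomputable def wrdMod (M X : ModuleCat.{u} A) : ℕ∞ :=
  sInf {d : ℕ∞ | ∃ n : ℕ, d = n ∧ wrdLE A M X n}

/-- The weak `M`-resolution dimension of the algebra `A`. -/
noncomputable def wrdAlg (M : ModuleCat.{u} A) : ℕ∞ :=
  sSup {d : ℕ∞ | ∃ X : ModuleCat.{u} A, Module.Finite A X ∧ d = wrdMod A M X}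

/-- The weak resolution dimension of `A`. -/
noncomputable def wrd : ℕ∞ :=
  sInf {d : ℕ∞ | ∃ M : ModuleCat.{u} A, Module.Finite A M ∧ d = wrdAlg A M}

end Paper

/-- A cosyzygy operator: `Cos M` is (up to isomorphism) the cokernel of an
injective envelope `M → I`, for every finitely generated module `M`. -/
def Paper.IsCosyzygyOp (A : Type u) [Ring A]
    (Cos : ModuleCat.{u} A → ModuleCat.{u} A) : Prop :=
  ∀ M : ModuleCat.{u} A, Module.Finite A M →
    ∃ (I : ModuleCat.{u} A) (ι : M →ₗ[A] I),
      Module.Finite A I ∧ Module.Injective A I ∧ Function.Injective ι ∧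
      (∀ N : Submodule A I, N ⊓ LinearMap.range ι = ⊥ → N = ⊥) ∧
      Nonempty (Cos M ≃ₗ[A] (I ⧸ LinearMap.range ι))

namespace Paper

section Linear

variable {A : Type u} [Ring A]

theorem exists_extension_of_injective {X Y Q : Type u} [AddCommGroup X] [Module A X]
    [AddCommGroup Y] [Module A Y] [AddCommGroup Q] [Module A Q] (hQ : Module.Injective A Q)
    (f : X →ₗ[A] Y) (hf : Function.Injective f) (g : X →ₗ[A] Q) :
    ∃ h : Y →ₗ[A] Q, ∀ x, h (f x) = g x :=
  hQ.out f hf g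

theorem injective_of_retract {X Q : Type u} [AddCommGroup X] [Module A X]
    [AddCommGroup Q] [Module A Q] (hQ : Module.Injective A Q)
    (s : X →ₗ[A] Q) (p : Q →ₗ[A] X) (hps : ∀ x, p (s x) = x) : Module.Injective A X := by
  refine ⟨fun Y Z _ _ _ _ f hf g => ?_⟩
  obtain ⟨h, hh⟩ := exists_extension_of_injective hQ f hf (s ∘ₗ g)
  exact ⟨p ∘ₗ h, fun x => by simp [hh, hps]⟩

theorem injective_prod {P Q : Type u} [AddCommGroup P] [Module A P]
    [AddCommGroup Q] [Module A Q] (hP : Module.Injective A P) (hQ : Module.Injective A Q) :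
    Module.Injective A (P × Q) := by
  refine ⟨fun Y Z _ _ _ _ f hf g => ?_⟩
  obtain ⟨h₁, hh₁⟩ := exists_extension_of_injective hP f hf (LinearMap.fst A P Q ∘ₗ g)
  obtain ⟨h₂, hh₂⟩ := exists_extension_of_injective hQ f hf (LinearMap.snd A P Q ∘ₗ g)
  exact ⟨h₁.prod h₂, fun x => by ext <;> simp [hh₁, hh₂]⟩

theorem injective_pi {ι : Type} {Q : Type u} [AddCommGroup Q] [Module A Q]
    (hQ : Module.Injective A Q) : Module.Injective A (ι → Q) := by
  refine ⟨fun Y Z _ _ _ _ f hf g => ?_⟩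
  choose h hh using fun i : ι =>
    exists_extension_of_injective hQ f hf (LinearMap.proj i ∘ₗ g)
  exact ⟨LinearMap.pi h, fun x => by ext i; simp [hh]⟩

theorem injective_punit : Module.Injective A PUnit.{u + 1} :=
  ⟨fun _ _ _ _ _ _ _ _ _ => ⟨0, fun _ => rfl⟩⟩

theorem exists_factor_of_surjective {X Y Z : Type u} [AddCommGroup X] [Module A X]
    [AddCommGroup Y] [Module A Y] [AddCommGroup Z] [Module A Z]
    (g : X →ₗ[A] Y) (hg : Function.Surjective g) (h : X →ₗ[A] Z)
    (hk : ∀ x, g x = 0 → h x = 0) : ∃ l : Y →ₗ[A] Z, ∀ x, l (g x) = h x := by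
  refine ⟨(LinearMap.ker g).liftQ h (fun x hx => hk x hx) ∘ₗ
    (g.quotKerEquivOfSurjective hg).symm.toLinearMap, fun x => ?_⟩
  have : (g.quotKerEquivOfSurjective hg).symm (g x) = (LinearMap.ker g).mkQ x := by
    rw [LinearEquiv.symm_apply_eq]; rfl
  change (LinearMap.ker g).liftQ h hk ((g.quotKerEquivOfSurjective hg).symm (g x)) = h x
  rw [this]
  exact Submodule.liftQ_apply _ _ _

/-- A retract has a complement. -/
theorem nonempty_prod_ker_equiv {X W : Type u} [AddCommGroup X] [Module A X]
    [AddCommGroup W] [Module A W] (s : X →ₗ[A] W) (p : W →ₗ[A] X) (hps : ∀ x, p (s x) = x) :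
    Nonempty ((X × LinearMap.ker p) ≃ₗ[A] W) := by
  refine ⟨LinearEquiv.ofBijective (s.coprod (LinearMap.ker p).subtype) ⟨?_, fun w => ?_⟩⟩
  · rw [injective_iff_map_eq_zero]
    rintro ⟨x, y, hy⟩ h
    have h' : s x + y = 0 := by simpa using h
    have hx : x = 0 := by
      have := congrArg p h'
      rwa [map_add, hps, LinearMap.mem_ker.1 hy, add_zero, map_zero] at this
    subst hx
    have hy0 : y = 0 := by simpa using h'
    subst hy0
    rfl
  · exact ⟨(p w, ⟨w - s (p w), by simp [hps]⟩), by simp⟩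

/-- The horseshoe construction on injective copresentations of length one. -/
theorem exists_horseshoe {P W V I Q J C : Type u}
    [AddCommGroup P] [Module A P] [AddCommGroup W] [Module A W] [AddCommGroup V] [Module A V]
    [AddCommGroup I] [Module A I] [AddCommGroup Q] [Module A Q] [AddCommGroup J] [Module A J]
    [AddCommGroup C] [Module A C]
    (f : P →ₗ[A] W) (g : W →ₗ[A] V) (hf : Function.Injective f) (hg : Function.Surjective g)
    (hfg : Function.Exact f g) (hI : Module.Injective A I)
    (i : P →ₗ[A] I) (p : I →ₗ[A] Q) (hi : Function.Injective i) (hp : Function.Surjective p)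
    (hip : Function.Exact i p)
    (j : V →ₗ[A] J) (q : J →ₗ[A] C) (hj : Function.Injective j) (hq : Function.Surjective q)
    (hjq : Function.Exact j q) :
    ∃ (e : W →ₗ[A] I × J) (a : Q →ₗ[A] (I × J) ⧸ LinearMap.range e)
      (b : ((I × J) ⧸ LinearMap.range e) →ₗ[A] C),
      Function.Injective e ∧ Function.Injective a ∧ Function.Surjective b ∧
        Function.Exact a b := by
  obtain ⟨d, hd⟩ := exists_extension_of_injective hI f hf i
  let e : W →ₗ[A] I × J := d.prod (j ∘ₗ g)
  have he (w : W) : e w = (d w, j (g w)) := rfl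
  obtain ⟨a, ha⟩ := exists_factor_of_surjective p hp
    ((LinearMap.range e).mkQ ∘ₗ LinearMap.inl A I J) (fun x hx => by
      obtain ⟨y, rfl⟩ := (hip x).1 hx
      have : (LinearMap.range e).mkQ (i y, 0) = 0 := by
        rw [Submodule.mkQ_apply, Submodule.Quotient.mk_eq_zero]
        exact ⟨f y, by rw [he, hd, hfg.apply_apply_eq_zero, map_zero]⟩
      simpa using this)
  obtain ⟨b, hb⟩ := exists_factor_of_surjective (LinearMap.range e).mkQ
    (Submodule.mkQ_surjective _) (q ∘ₗ LinearMap.snd A I J) (fun x hx => by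
      rw [Submodule.mkQ_apply, Submodule.Quotient.mk_eq_zero] at hx
      obtain ⟨w, rfl⟩ := hx
      simp [he, hjq.apply_apply_eq_zero])
  refine ⟨e, a, b, ?_, ?_, ?_, ?_⟩
  · rw [injective_iff_map_eq_zero]
    intro w hw
    rw [he, Prod.mk_eq_zero] at hw
    obtain ⟨y, rfl⟩ := (hfg w).1 ((injective_iff_map_eq_zero j).1 hj _ hw.2)
    rw [hd] at hw
    rw [(injective_iff_map_eq_zero i).1 hi _ hw.1, map_zero]
  · rw [injective_iff_map_eq_zero]
    intro z hz
    obtain ⟨x, rfl⟩ := hp z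
    rw [ha] at hz
    replace hz : (LinearMap.range e).mkQ (x, 0) = 0 := hz
    rw [Submodule.mkQ_apply, Submodule.Quotient.mk_eq_zero] at hz
    obtain ⟨w, hw⟩ := hz
    rw [he, Prod.mk.injEq] at hw
    obtain ⟨y, rfl⟩ := (hfg w).1 ((injective_iff_map_eq_zero j).1 hj _ hw.2)
    rw [hd] at hw
    rw [← hw.1, hip.apply_apply_eq_zero]
  · intro c
    obtain ⟨y, rfl⟩ := hq c
    exact ⟨(LinearMap.range e).mkQ (0, y), by rw [hb]; rfl⟩
  · intro z
    constructor
    · intro hz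
      obtain ⟨⟨x, y⟩, rfl⟩ := Submodule.mkQ_surjective _ z
      rw [hb] at hz
      obtain ⟨v, hv⟩ := (hjq y).1 hz
      obtain ⟨w, rfl⟩ := hg v
      refine ⟨p (x - d w), ?_⟩
      rw [ha]
      change (LinearMap.range e).mkQ (x - d w, 0) = (LinearMap.range e).mkQ (x, y)
      rw [← sub_eq_zero, ← map_sub, Submodule.mkQ_apply, Submodule.Quotient.mk_eq_zero]
      exact ⟨-w, by rw [map_neg, he, hv]; ext <;> simp⟩
    · rintro ⟨t, rfl⟩
      obtain ⟨x, rfl⟩ := hp t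
      rw [ha]
      change b ((LinearMap.range e).mkQ (x, 0)) = 0
      rw [hb]
      simp

/-- An injective summand can be cancelled from an injective copresentation of length one. -/
theorem exists_cancel_injective {Z J I C : Type u}
    [AddCommGroup Z] [Module A Z] [AddCommGroup J] [Module A J] [AddCommGroup I] [Module A I]
    [AddCommGroup C] [Module A C] (hJ : Module.Injective A J) (hI : Module.Injective A I)
    (i : Z × J →ₗ[A] I) (p : I →ₗ[A] C)
    (hi : Function.Injective i) (hp : Function.Surjective p) (hip : Function.Exact i p) :
    ∃ (I' : ModuleCat.{u} A) (i' : Z →ₗ[A] I') (p' : I' →ₗ[A] C), Module.Injective A I' ∧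
      Function.Injective i' ∧ Function.Surjective p' ∧ Function.Exact i' p' := by
  let t : J →ₗ[A] I := i ∘ₗ LinearMap.inr A Z J
  have ht (y : J) : t y = i (0, y) := rfl
  have htinj : Function.Injective t := hi.comp LinearMap.inr_injective
  obtain ⟨r, hr⟩ := exists_extension_of_injective hJ t htinj LinearMap.id
  let N := LinearMap.range t
  have hN : ∀ x, N.mkQ x = 0 ↔ ∃ y, t y = x := fun x => by
    rw [Submodule.mkQ_apply, Submodule.Quotient.mk_eq_zero]; rfl
  obtain ⟨s, hs⟩ := exists_factor_of_surjective N.mkQ (Submodule.mkQ_surjective _)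
    (LinearMap.id - t ∘ₗ r) (fun x hx => by
      obtain ⟨y, rfl⟩ := (hN x).1 hx
      simp [hr])
  obtain ⟨p', hp'⟩ := exists_factor_of_surjective N.mkQ (Submodule.mkQ_surjective _) p
    (fun x hx => by
      obtain ⟨y, rfl⟩ := (hN x).1 hx
      exact hip.apply_apply_eq_zero _)
  refine ⟨ModuleCat.of A (I ⧸ N), N.mkQ ∘ₗ i ∘ₗ LinearMap.inl A Z J, p',
    injective_of_retract hI s N.mkQ (fun z => ?_), ?_, fun c => ?_, fun z => ?_⟩
  · obtain ⟨x, rfl⟩ := Submodule.mkQ_surjective _ z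
    rw [hs, ← sub_eq_zero, ← map_sub, hN]
    exact ⟨-r x, by simp⟩
  · rw [injective_iff_map_eq_zero]
    intro z hz
    obtain ⟨y, hy⟩ := (hN (i (z, 0))).1 hz
    have := hi hy
    simp only [LinearMap.inr_apply, Prod.mk.injEq] at this
    exact this.1.symm
  · obtain ⟨x, rfl⟩ := hp c
    exact ⟨N.mkQ x, hp' x⟩
  · obtain ⟨x, rfl⟩ := Submodule.mkQ_surjective _ z
    rw [hp']
    constructor
    · intro hx
      obtain ⟨⟨z, y⟩, rfl⟩ := (hip x).1 hx
      refine ⟨z, ?_⟩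
      change N.mkQ (i (z, 0)) = N.mkQ (i (z, y))
      rw [← sub_eq_zero, ← map_sub, hN]
      exact ⟨-y, by rw [ht, ← map_sub]; simp⟩
    · rintro ⟨z, hz⟩
      rw [← hp', ← hz]
      change p' (N.mkQ (i (z, 0))) = 0
      rw [hp', hip.apply_apply_eq_zero]

/-- Pushing out `0 → ker g × V → L × V → X → 0` along an embedding of `ker g × V` into an
injective module. -/
theorem exists_pushout_exact {L X V U I C : Type u}
    [AddCommGroup L] [Module A L] [AddCommGroup X] [Module A X] [AddCommGroup V] [Module A V]
    [AddCommGroup U] [Module A U] [AddCommGroup I] [Module A I] [AddCommGroup C] [Module A C]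
    (g : L →ₗ[A] X) (hg : Function.Surjective g) (hI : Module.Injective A I)
    (i : LinearMap.ker g × V →ₗ[A] I) (p : I →ₗ[A] C)
    (hi : Function.Injective i) (hp : Function.Surjective p) (hip : Function.Exact i p) :
    ∃ (a : (L × V) × U →ₗ[A] (X × U) × I) (b : (X × U) × I →ₗ[A] C),
      Function.Injective a ∧ Function.Surjective b ∧ Function.Exact a b := by
  obtain ⟨d, hd⟩ := exists_extension_of_injective hI
    ((LinearMap.ker g).subtype.prodMap (LinearMap.id : V →ₗ[A] V))
    (Prod.map_injective.2 ⟨Subtype.val_injective, Function.injective_id⟩) i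
  replace hd : ∀ (x : LinearMap.ker g) (v : V), d (x.1, v) = i (x, v) := fun x v => hd (x, v)
  obtain ⟨c, hc⟩ := exists_factor_of_surjective g hg (p ∘ₗ d ∘ₗ LinearMap.inl A L V)
    (fun x hx => by
      change p (d ((⟨x, hx⟩ : LinearMap.ker g).1, 0)) = 0
      rw [hd, hip.apply_apply_eq_zero])
  replace hc : ∀ x, c (g x) = p (d (x, 0)) := hc
  let a : (L × V) × U →ₗ[A] (X × U) × I :=
    (g.prodMap LinearMap.id ∘ₗ (LinearMap.fst A L V).prodMap LinearMap.id).prod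
      (d ∘ₗ LinearMap.fst A (L × V) U)
  have ha (l : L) (v : V) (w : U) : a ((l, v), w) = ((g l, w), d (l, v)) := rfl
  let b : (X × U) × I →ₗ[A] C :=
    p ∘ₗ LinearMap.snd A (X × U) I - c ∘ₗ LinearMap.fst A X U ∘ₗ LinearMap.fst A (X × U) I
  have hb (x : X) (w : U) (y : I) : b ((x, w), y) = p y - c x := rfl
  refine ⟨a, b, ?_, fun z => ?_, ?_⟩
  · rw [injective_iff_map_eq_zero]
    rintro ⟨⟨l, v⟩, w⟩ h
    rw [ha, Prod.mk_eq_zero, Prod.mk_eq_zero] at h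
    obtain ⟨⟨hl, rfl⟩, h⟩ := h
    let k : LinearMap.ker g := ⟨l, LinearMap.mem_ker.2 hl⟩
    have hkv : (k, v) = 0 := (injective_iff_map_eq_zero i).1 hi _ ((hd k v).symm.trans h)
    obtain ⟨hk, rfl⟩ := Prod.mk_eq_zero.1 hkv
    obtain rfl : l = 0 := congrArg Subtype.val hk
    rfl
  · obtain ⟨y, rfl⟩ := hp z
    exact ⟨((0, 0), y), by rw [hb, map_zero, sub_zero]⟩
  · rintro ⟨⟨x, w⟩, y⟩
    constructor
    · intro h
      obtain ⟨l, rfl⟩ := hg x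
      rw [hb, hc, ← map_sub] at h
      obtain ⟨⟨k, v⟩, hk⟩ := (hip _).1 h
      refine ⟨((l + k.1, v), w), ?_⟩
      have h1 : ((l + k.1, v) : L × V) = (l, 0) + (k.1, v) := by simp
      rw [ha, map_add, LinearMap.mem_ker.1 k.2, add_zero, h1, map_add, hd, hk,
        add_sub_cancel]
    · rintro ⟨⟨⟨l, v⟩, w'⟩, h⟩
      rw [← h, ha, hb, hc, ← map_sub, ← map_sub, Prod.mk_sub_mk, sub_self, sub_zero]
      change p (d ((0 : LinearMap.ker g).1, v)) = 0
      rw [hd, hip.apply_apply_eq_zero]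

end Linear

section Classes

variable {A : Type u} [Ring A]

theorem isSES_of_exact {X Y Z : ModuleCat.{u} A} {f : X →ₗ[A] Y} {g : Y →ₗ[A] Z}
    (hf : Function.Injective f) (hg : Function.Surjective g) (h : Function.Exact f g) :
    IsSES A f g :=
  ⟨hf, hg, (LinearMap.exact_iff.1 h).symm⟩

theorem mem_addOf_iff {M X : ModuleCat.{u} A} :
    X ∈ addOf A M ↔
      ∃ (n : ℕ) (Y : ModuleCat.{u} A), Nonempty ((X × Y) ≃ₗ[A] (Fin n → M)) := by
  constructor
  · rintro ⟨n, N, Y, hN, h⟩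
    obtain rfl : N = fun _ => M := funext hN
    exact ⟨n, Y, h⟩
  · rintro ⟨n, Y, h⟩
    exact ⟨n, fun _ => M, Y, fun _ => rfl, h⟩

theorem memAdd_of_equiv_pi {S : Set (ModuleCat.{u} A)} {X : ModuleCat.{u} A} {n : ℕ}
    {N : Fin n → ModuleCat.{u} A} (hN : ∀ i, N i ∈ S) (e : X ≃ₗ[A] ((i : Fin n) → N i)) :
    memAdd A S X :=
  ⟨n, N, ModuleCat.of A PUnit, hN, ⟨(LinearEquiv.prodUnique (M₂ := PUnit.{u + 1})).trans e⟩⟩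

theorem memAdd_of_mem {S : Set (ModuleCat.{u} A)} {X : ModuleCat.{u} A} (hX : X ∈ S) :
    memAdd A S X :=
  memAdd_of_equiv_pi (N := fun _ : Fin 1 => X) (fun _ => hX)
    (LinearEquiv.funUnique (Fin 1) A X).symm

theorem memAdd_of_retract {S : Set (ModuleCat.{u} A)} {X W : ModuleCat.{u} A}
    (hW : memAdd A S W) (s : X →ₗ[A] W) (p : W →ₗ[A] X) (hps : ∀ x, p (s x) = x) :
    memAdd A S X := by
  obtain ⟨n, N, Y, hN, ⟨e⟩⟩ := hW
  obtain ⟨e'⟩ := nonempty_prod_ker_equiv (e.toLinearMap ∘ₗ LinearMap.inl A W Y ∘ₗ s)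
    (p ∘ₗ LinearMap.fst A W Y ∘ₗ e.symm.toLinearMap) (fun x => by simp [hps])
  exact ⟨n, N, ModuleCat.of A _, hN, ⟨e'⟩⟩

theorem addOf_prod {M X Y : ModuleCat.{u} A} (hX : X ∈ addOf A M) (hY : Y ∈ addOf A M) :
    ModuleCat.of A (X × Y) ∈ addOf A M := by
  obtain ⟨m, X', ⟨e⟩⟩ := mem_addOf_iff.1 hX
  obtain ⟨n, Y', ⟨e'⟩⟩ := mem_addOf_iff.1 hY
  refine mem_addOf_iff.2 ⟨m + n, ModuleCat.of A (X' × Y'), ⟨?_⟩⟩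
  exact (LinearEquiv.prodProdProdComm A X Y X' Y').trans <| (e.prodCongr e').trans <|
    (LinearEquiv.sumArrowLequivProdArrow (Fin m) (Fin n) A M).symm.trans <|
    LinearEquiv.funCongrLeft A M finSumFinEquiv.symm

theorem bracket_of_retract {T X W : ModuleCat.{u} A} {n : ℕ} (hW : W ∈ bracket A T (n + 1))
    (s : X →ₗ[A] W) (p : W →ₗ[A] X) (hps : ∀ x, p (s x) = x) :
    X ∈ bracket A T (n + 1) := by
  cases n with
  | zero => exact memAdd_of_retract hW s p hps
  | succ n => exact memAdd_of_retract hW s p hps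

theorem ResLen.succ {M : ModuleCat.{u} A} :
    ∀ {n : ℕ} {X : ModuleCat.{u} A}, ResLen A M X n → ResLen A M X (n + 1)
  | 0, X, h => by
    refine ⟨X, LinearMap.id, h, Function.surjective_id, ?_⟩
    have : Subsingleton (LinearMap.ker (LinearMap.id : X →ₗ[A] X)) := by
      rw [LinearMap.ker_id]; infer_instance
    exact memAdd_of_equiv_pi (N := fun _ : Fin 0 => M) (fun _ => rfl)
      ⟨0, 0, fun _ => Subsingleton.elim _ _, fun _ => Subsingleton.elim _ _⟩
  | _ + 1, _, ⟨M₀, g, hM₀, hg, h⟩ => ⟨M₀, g, hM₀, hg, ResLen.succ h⟩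

theorem ResLen.mono {M X : ModuleCat.{u} A} {n m : ℕ} (hnm : n ≤ m) (h : ResLen A M X n) :
    ResLen A M X m := by
  induction hnm with
  | refl => exact h
  | step _ ih => exact ih.succ

theorem exists_wrdLE_of_wrdMod_le {M X : ModuleCat.{u} A} {m : ℕ}
    (h : wrdMod A M X ≤ (m : ℕ∞)) : ∃ n ≤ m, wrdLE A M X n := by
  have hne : {d : ℕ∞ | ∃ n : ℕ, d = n ∧ wrdLE A M X n}.Nonempty := by
    by_contra hemp
    rw [Set.not_nonempty_iff_eq_empty] at hemp
    rw [wrdMod, hemp, sInf_empty] at h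
    exact absurd h (by simp)
  obtain ⟨n, hn, hX⟩ := csInf_mem hne
  refine ⟨n, ?_, hX⟩
  rw [wrdMod, hn] at h
  exact_mod_cast h

/-- `W` has a filtration with subquotients finite powers of `N j, N (j + 1), …, N (j + n)`,
starting from a submodule isomorphic to a power of `N j`. -/
def PowFiltered (N : ℕ → ModuleCat.{u} A) : ℕ → ℕ → ModuleCat.{u} A → Prop
  | j, 0, W => ∃ r : ℕ, Nonempty (W ≃ₗ[A] (Fin r → N j))
  | j, n + 1, W => ∃ (r : ℕ) (V : ModuleCat.{u} A) (f : (Fin r → N j) →ₗ[A] W)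
      (g : W →ₗ[A] V), Function.Injective f ∧ Function.Surjective g ∧ Function.Exact f g ∧
        PowFiltered N (j + 1) n V

theorem PowFiltered.finite {N : ℕ → ModuleCat.{u} A} (hN : ∀ j, Module.Finite A (N j)) :
    ∀ {n j : ℕ} {W : ModuleCat.{u} A}, PowFiltered N j n W → Module.Finite A W
  | 0, j, _, ⟨_, ⟨e⟩⟩ => have := hN j; Module.Finite.equiv e.symm
  | _ + 1, j, W, ⟨_, _, f, g, _, hg, hfg, hV⟩ => by
    have := hN j
    have := hV.finite hN
    have : Module.Finite A (LinearMap.ker g) := by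
      rw [LinearMap.exact_iff.1 hfg]; infer_instance
    have : Module.Finite A (W ⧸ LinearMap.ker g) :=
      Module.Finite.equiv (g.quotKerEquivOfSurjective hg).symm
    exact Module.Finite.of_submodule_quotient (LinearMap.ker g)

theorem PowFiltered.mem_bracket {N : ℕ → ModuleCat.{u} A} (hN : ∀ j, Module.Finite A (N j))
    {T : ModuleCat.{u} A} {m : ℕ} (hT : ∀ j ≤ m, N j ∈ addOf A T) :
    ∀ {n j : ℕ} {W : ModuleCat.{u} A}, j + n ≤ m → PowFiltered N j n W →
      W ∈ bracket A T (n + 1) := by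
  have hpow : ∀ j ≤ m, ∀ r : ℕ, ModuleCat.of A (Fin r → N j) ∈ addOf A T := by
    intro j hj r
    induction r with
    | zero =>
      exact memAdd_of_equiv_pi (N := fun _ : Fin 0 => T) (fun _ => rfl)
        ⟨0, 0, fun _ => Subsingleton.elim _ _, fun _ => Subsingleton.elim _ _⟩
    | succ r ih =>
      let e := Fin.consLinearEquiv A (fun _ : Fin (r + 1) => (N j : Type u))
      exact memAdd_of_retract (addOf_prod (hT j hj) ih) e.symm.toLinearMap e.toLinearMap
        e.apply_symm_apply
  intro n
  induction n with
  | zero =>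
    rintro j W hj ⟨r, ⟨e⟩⟩
    exact memAdd_of_retract (hpow j hj r) e.toLinearMap e.symm.toLinearMap e.symm_apply_apply
  | succ n ih =>
    intro j W hj hW
    have hfin := hW.finite hN
    obtain ⟨r, V, f, g, hf, hg, hfg, hV⟩ := hW
    exact memAdd_of_mem ⟨hfin, ModuleCat.of A (Fin r → N j), V, f, g,
      hpow j (by omega) r, ih (by omega) hV, isSES_of_exact hf hg hfg⟩

/-- Each `N (j + 1)` is the cokernel of an embedding of `N j` into an injective module. -/
def IsCosyzygySeq (N : ℕ → ModuleCat.{u} A) : Prop :=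
  ∀ j, ∃ (I : ModuleCat.{u} A) (i : N j →ₗ[A] I) (p : I →ₗ[A] N (j + 1)),
    Module.Injective A I ∧ Function.Injective i ∧ Function.Surjective p ∧ Function.Exact i p

theorem IsCosyzygySeq.pow {N : ℕ → ModuleCat.{u} A} (hN : IsCosyzygySeq N) (j r : ℕ) :
    ∃ (I : ModuleCat.{u} A) (i : (Fin r → N j) →ₗ[A] I) (p : I →ₗ[A] (Fin r → N (j + 1))),
      Module.Injective A I ∧ Function.Injective i ∧ Function.Surjective p ∧
        Function.Exact i p := by
  obtain ⟨I, i, p, hI, hi, hp, hip⟩ := hN j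
  refine ⟨ModuleCat.of A (Fin r → I), i.compLeft (Fin r), p.compLeft (Fin r),
    injective_pi hI, hi.comp_left, hp.comp_left, fun x => ⟨fun hx => ?_, ?_⟩⟩
  · choose y hy using fun k => (hip (x k)).1 (congrFun hx k)
    exact ⟨y, funext hy⟩
  · rintro ⟨y, rfl⟩
    exact funext fun k => hip.apply_apply_eq_zero (y k)

theorem PowFiltered.exists_cosyzygy {N : ℕ → ModuleCat.{u} A} (hN : IsCosyzygySeq N) :
    ∀ {n j : ℕ} {W : ModuleCat.{u} A}, PowFiltered N j n W →
      ∃ (I C : ModuleCat.{u} A) (i : W →ₗ[A] I) (p : I →ₗ[A] C), Module.Injective A I ∧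
        Function.Injective i ∧ Function.Surjective p ∧ Function.Exact i p ∧
          PowFiltered N (j + 1) n C
  | 0, j, W, ⟨r, ⟨e⟩⟩ => by
    obtain ⟨I, i, p, hI, hi, hp, hip⟩ := hN.pow j r
    refine ⟨I, ModuleCat.of A (Fin r → N (j + 1)), i ∘ₗ e.toLinearMap, p, hI,
      hi.comp e.injective, hp, fun x => (hip x).trans ⟨?_, ?_⟩, r, ⟨LinearEquiv.refl A _⟩⟩
    · rintro ⟨y, rfl⟩
      exact ⟨e.symm y, by simp⟩
    · rintro ⟨y, rfl⟩
      exact ⟨e y, rfl⟩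
  | n + 1, j, W, ⟨r, V, f, g, hf, hg, hfg, hV⟩ => by
    obtain ⟨I, i, p, hI, hi, hp, hip⟩ := hN.pow j r
    obtain ⟨J, C, k, q, hJ, hk, hq, hkq, hC⟩ := hV.exists_cosyzygy hN
    obtain ⟨e, a, b, he, ha, hb, hab⟩ :=
      exists_horseshoe f g hf hg hfg hI i p hi hp hip k q hk hq hkq
    exact ⟨ModuleCat.of A (I × J), ModuleCat.of A ((I × J) ⧸ LinearMap.range e), e,
      (LinearMap.range e).mkQ, injective_prod hI hJ, he, Submodule.mkQ_surjective _,
      LinearMap.exact_map_mkQ_range e, r, C, a, b, ha, hb, hab, hC⟩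

/-- A module with an `add (N 0)`-resolution of length `n` becomes filtered by powers of
`N 0, …, N n` after adding a summand from `add (N 0)` and an injective summand. -/
theorem ResLen.exists_powFiltered {N : ℕ → ModuleCat.{u} A} (hN : IsCosyzygySeq N) :
    ∀ {n : ℕ} {X : ModuleCat.{u} A}, ResLen A (N 0) X n →
      ∃ V J : ModuleCat.{u} A, V ∈ addOf A (N 0) ∧ Module.Injective A J ∧
        PowFiltered N 0 n (ModuleCat.of A ((X × V) × J)) := by
  have compl : ∀ {X Y : ModuleCat.{u} A} {r : ℕ}, ((X × Y) ≃ₗ[A] (Fin r → N 0)) →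
      Y ∈ addOf A (N 0) := fun {X Y r} e =>
    mem_addOf_iff.2 ⟨r, X, ⟨(LinearEquiv.prodComm A Y X).trans e⟩⟩
  intro n
  induction n with
  | zero =>
    intro X hX
    obtain ⟨r, Y, ⟨e⟩⟩ := mem_addOf_iff.1 hX
    exact ⟨Y, ModuleCat.of A PUnit, compl e, injective_punit, r,
      ⟨(LinearEquiv.prodUnique (M₂ := PUnit.{u + 1})).trans e⟩⟩
  | succ n ih =>
    rintro X ⟨L, g, hL, hg, h⟩
    obtain ⟨V, J, hV, hJ, hF⟩ := ih h
    obtain ⟨I, C, i, p, hI, hi, hp, hip, hC⟩ := hF.exists_cosyzygy hN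
    obtain ⟨I', i', p', hI', hi', hp', hip'⟩ := exists_cancel_injective hJ hI i p hi hp hip
    obtain ⟨r, U, ⟨e⟩⟩ := mem_addOf_iff.1 (addOf_prod hL hV)
    obtain ⟨a, b, ha, hb, hab⟩ :=
      exists_pushout_exact (U := U) g hg hI' i' p' hi' hp' hip'
    refine ⟨U, I', compl e, hI', r, C, a ∘ₗ e.symm.toLinearMap, b,
      ha.comp e.symm.injective, hb, fun x => (hab x).trans ⟨?_, ?_⟩, hC⟩
    · rintro ⟨y, rfl⟩
      exact ⟨e y, congrArg a (e.symm_apply_apply y)⟩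
    · rintro ⟨y, rfl⟩
      exact ⟨e.symm y, rfl⟩

theorem IsCosyzygyOp.finite_iterate {Cos : ModuleCat.{u} A → ModuleCat.{u} A}
    (hCos : IsCosyzygyOp A Cos) {M : ModuleCat.{u} A} (hM : Module.Finite A M) (j : ℕ) :
    Module.Finite A (Cos^[j] M) := by
  induction j with
  | zero => exact hM
  | succ j ih =>
    obtain ⟨I, i, hfin, -, -, -, ⟨e⟩⟩ := hCos _ ih
    rw [Function.iterate_succ_apply']
    exact Module.Finite.equiv e.symm

theorem IsCosyzygyOp.isCosyzygySeq {Cos : ModuleCat.{u} A → ModuleCat.{u} A}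
    (hCos : IsCosyzygyOp A Cos) {M : ModuleCat.{u} A} (hM : Module.Finite A M) :
    IsCosyzygySeq (fun j => Cos^[j] M) := by
  intro j
  obtain ⟨I, i, -, hI, hi, -, ⟨e⟩⟩ := hCos _ (hCos.finite_iterate hM j)
  beta_reduce
  rw [Function.iterate_succ_apply']
  refine ⟨I, i, e.symm.toLinearMap ∘ₗ (LinearMap.range i).mkQ, hI, hi,
    e.symm.surjective.comp (Submodule.mkQ_surjective _), fun x => ?_⟩
  rw [← LinearMap.exact_map_mkQ_range i x]
  exact e.symm.map_eq_zero_iff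

end Classes

end Paper

open Paper in
/-- If `wrd(A) = m` is witnessed by a module `M` with `M`-wrd(A) = m,
then `A-mod = [⊕_{i=0}^m Ω^{-i}(M)]_{m+1}`, and hence `ed(A) ≤ m`. -/
theorem stmt18 (k : Type u) [CommRing k] [IsArtinianRing k]
    (A : Type u) [Ring A] [Algebra k A] [Module.Finite k A]
    (Cos : ModuleCat.{u} A → ModuleCat.{u} A) (hCos : IsCosyzygyOp A Cos)
    (m : ℕ) (hwrd : wrd A = (m : ℕ∞))
    (M : ModuleCat.{u} A) (hM : Module.Finite A M) (hMw : wrdAlg A M = (m : ℕ∞)) :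
    (∀ X : ModuleCat.{u} A, Module.Finite A X →
      X ∈ bracket A (ModuleCat.of A ((i : Fin (m+1)) → (Cos^[i.1] M : Type u))) (m+1)) ∧
      extDim A ≤ (m : ℕ∞) := by
  have hfin := hCos.finite_iterate hM
  have key : ∀ X : ModuleCat.{u} A, Module.Finite A X →
      X ∈ bracket A (ModuleCat.of A ((i : Fin (m+1)) → (Cos^[i.1] M : Type u))) (m+1) := by
    intro X hX
    have hle : wrdMod A M X ≤ (m : ℕ∞) := hMw ▸ le_sSup ⟨X, hX, rfl⟩
    obtain ⟨n, hn, Y, -, hres⟩ := exists_wrdLE_of_wrdMod_le hle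
    obtain ⟨V, J, -, -, hF⟩ :=
      ResLen.exists_powFiltered (hCos.isCosyzygySeq hM) (hres.mono hn)
    refine bracket_of_retract (hF.mem_bracket hfin (fun j hj => ?_) (zero_add m).le)
      (LinearMap.inl A _ _ ∘ₗ LinearMap.inl A _ _ ∘ₗ LinearMap.inl A X Y)
      (LinearMap.fst A X Y ∘ₗ LinearMap.fst A (X × Y) V ∘ₗ LinearMap.fst A ((X × Y) × V) J)
      (fun x => rfl)
    let i : Fin (m + 1) := ⟨j, Nat.lt_succ_of_le hj⟩
    exact memAdd_of_retract
      (W := ModuleCat.of A ((i : Fin (m + 1)) → (Cos^[i.1] M : Type u))) (memAdd_of_mem rfl)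
      (LinearMap.single A (fun i : Fin (m + 1) => (Cos^[i.1] M : Type u)) i)
      (LinearMap.proj i)
      (fun x => Pi.single_eq_same (M := fun i : Fin (m + 1) => (Cos^[i.1] M : Type u)) i x)
  refine ⟨key, sInf_le ⟨m, rfl, _, ?_, key⟩⟩
  have : ∀ i : Fin (m + 1), Module.Finite A (Cos^[i.1] M) := fun i => hfin i.1
  exact Module.Finite.pi
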